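/- Let M = (W,R,V) be a Kripke model, w ∈ W, φ a sentence of the modal μ-calculus in normal form, and Γ the successor cardinal of the cardinality of W (regarded as an ordinal). Then M,w ⊨ φ in the standard compositional semantics if and only if Eloise has a winning strategy in the Γ-bounded evaluation game (M, w, φ, Γ). -/

import Mathlib

/-- Formulae of the modal μ-calculus, with negation only on proposition symbols:
`φ ::= p | ¬p | X | φ∨φ | φ∧φ | ◇φ | □φ | μX φ | νX φ`. -/
inductive Formula (Φ Λ : Type) : Type
  | atom  : Φ → Formula Φ Λ
  | natom : Φ → Formula Φ Λ
  | label : Λ → Formula Φ Λ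
  | or    : Formula Φ Λ → Formula Φ Λ → Formula Φ Λ
  | and   : Formula Φ Λ → Formula Φ Λ → Formula Φ Λ
  | dia   : Formula Φ Λ → Formula Φ Λ
  | box   : Formula Φ Λ → Formula Φ Λ
  | mu    : Λ → Formula Φ Λ → Formula Φ Λ
  | nu    : Λ → Formula Φ Λ → Formula Φ Λ

/-- A Kripke model `M = (W,R,V)` over the (nonempty) set `W` of worlds. -/
structure Kripke (Φ W : Type) where
  R : W → W → Prop
  V : Φ → Set W

variable {Φ Λ W : Type}
/-- Standard compositional semantics of the modal μ-calculus: `sat M φ s` is the set of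
worlds where `φ` holds under assignment `s`.  The `μX ψ` (resp. `νX ψ`) clause is the least
(resp. greatest) fixed point of the operator `A ↦ sat M ψ (s[A/X])`, given à la
Knaster–Tarski. -/
def sat [DecidableEq Λ] (M : Kripke Φ W) : Formula Φ Λ → (Λ → Set W) → Set W
  | .atom p, _ => M.V p
  | .natom p, _ => (M.V p)ᶜ
  | .label X, s => s X
  | .or φ ψ, s => sat M φ s ∪ sat M ψ s
  | .and φ ψ, s => sat M φ s ∩ sat M ψ s
  | .dia φ, s => {w | ∃ v, M.R w v ∧ v ∈ sat M φ s}
  | .box φ, s => {w | ∀ v, M.R w v → v ∈ sat M φ s}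
  | .mu X φ, s => sInf {A | sat M φ (Function.update s X A) ⊆ A}
  | .nu X φ, s => sSup {A | A ⊆ sat M φ (Function.update s X A)}
/-- The set of label symbols occurring free in a formula. -/
def freeLabels : Formula Φ Λ → Set Λ
  | .atom _ => ∅
  | .natom _ => ∅
  | .label X => {X}
  | .or φ ψ => freeLabels φ ∪ freeLabels ψ
  | .and φ ψ => freeLabels φ ∪ freeLabels ψ
  | .dia φ => freeLabels φ
  | .box φ => freeLabels φ
  | .mu X φ => freeLabels φ \ {X}
  | .nu X φ => freeLabels φ \ {X}

/-- A sentence is a formula with no free label symbols. -/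
def IsSentence (φ : Formula Φ Λ) : Prop := freeLabels φ = ∅

/-- The list of label symbols bound by the μ- and ν-operator occurrences of a formula
(with multiplicity). -/
def binderList : Formula Φ Λ → List Λ
  | .atom _ => []
  | .natom _ => []
  | .label _ => []
  | .or φ ψ => binderList φ ++ binderList ψ
  | .and φ ψ => binderList φ ++ binderList ψ
  | .dia φ => binderList φ
  | .box φ => binderList φ
  | .mu X φ => X :: binderList φ
  | .nu X φ => X :: binderList φ

/-- A formula is in normal form if each label symbol occurs at most once bound by a
μ- or ν-operator in it. -/
def NormalForm (φ : Formula Φ Λ) : Prop := (binderList φ).Nodup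
open scoped Classical

/-- The two players of the evaluation game. -/
inductive Player : Type
  | eloise
  | abelard
deriving DecidableEq

/-- A position `(w, φ, c)` of a Γ-bounded evaluation game for a sentence `φ₀`: a world `w`,
an occurrence of a subformula of `φ₀` (represented by its address `addr` in the syntax tree
of `φ₀`), and a clock mapping `c` assigning ordinals to (addresses of) subformula
occurrences of `φ₀`. -/
structure GPos (W : Type) where
  world : W
  addr : List ℕ
  clock : List ℕ → Ordinal

/-- The subformula occurrence of `φ` at address `o` in its syntax tree
(`0` = left/unique child, `1` = right child), if any. -/
def nodeAt : Formula Φ Λ → List ℕ → Option (Formula Φ Λ)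
  | φ, [] => some φ
  | .or φ _, 0 :: t => nodeAt φ t
  | .or _ ψ, 1 :: t => nodeAt ψ t
  | .and φ _, 0 :: t => nodeAt φ t
  | .and _ ψ, 1 :: t => nodeAt ψ t
  | .dia φ, 0 :: t => nodeAt φ t
  | .box φ, 0 :: t => nodeAt φ t
  | .mu _ φ, 0 :: t => nodeAt φ t
  | .nu _ φ, 0 :: t => nodeAt φ t
  | _, _ => none

/-- Whether the occurrence at address `o` in `φ₀` is a μν-subformula occurrence. -/
def muNuAt (φ₀ : Formula Φ Λ) (o : List ℕ) : Bool :=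
  match nodeAt φ₀ o with
  | some (.mu _ _) => true
  | some (.nu _ _) => true
  | _ => false

/-- Whether the occurrence at address `o` in `φ₀` is of the form `μX ψ` or `νX ψ`. -/
def bindsAt [DecidableEq Λ] (φ₀ : Formula Φ Λ) (X : Λ) (o : List ℕ) : Bool :=
  match nodeAt φ₀ o with
  | some (.mu Y _) => decide (Y = X)
  | some (.nu Y _) => decide (Y = X)
  | _ => false

/-- The (address of the) reference formula `rf(X)` of an occurrence of the label `X`
at address `o` in `φ₀`: the innermost (longest) binder `μX ψ` / `νX ψ` on the branch
from the root to `o`. -/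
def refOcc [DecidableEq Λ] (φ₀ : Formula Φ Λ) (X : Λ) (o : List ℕ) : Option (List ℕ) :=
  (o.inits.filter (fun o' => bindsAt φ₀ X o')).getLast?

/-- The player (if any) to move at a position: Eloise resolves `∨`, `◇`, `μ` and labels
bound by `μ`; Abelard resolves `∧`, `□`, `ν` and labels bound by `ν`; nobody moves at
literals. -/
def turn [DecidableEq Λ] (φ₀ : Formula Φ Λ) (p : GPos W) : Option Player :=
  match nodeAt φ₀ p.addr with
  | some (.or _ _) => some .eloise
  | some (.and _ _) => some .abelard
  | some (.dia _) => some .eloise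
  | some (.box _) => some .abelard
  | some (.mu _ _) => some .eloise
  | some (.nu _ _) => some .abelard
  | some (.label X) =>
      match (refOcc φ₀ X p.addr).bind (nodeAt φ₀) with
      | some (.mu _ _) => some .eloise
      | some (.nu _ _) => some .abelard
      | _ => none
  | _ => none

/-- The clock mapping after a move at a label occurrence whose reference formula sits at
address `r`: the clock of `r` becomes `γ'`, clocks of all μν-subformula occurrences of the
body of the reference formula are reset to `Γ`, all other clocks are unchanged. -/
def clockReset (Γ γ' : Ordinal) (r : List ℕ) (c : List ℕ → Ordinal) : List ℕ → Ordinal :=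
  fun o => if o = r then γ' else if (r ++ [0]).isPrefixOf o then Γ else c o

/-- The set of positions reachable from `p` in one round of the Γ-bounded evaluation game
for `φ₀` on `M`, according to the rules of the game. -/
def moves [DecidableEq Λ] (M : Kripke Φ W) (φ₀ : Formula Φ Λ) (Γ : Ordinal)
    (p : GPos W) : Set (GPos W) :=
  match nodeAt φ₀ p.addr with
  | some (.or _ _) => {⟨p.world, p.addr ++ [0], p.clock⟩, ⟨p.world, p.addr ++ [1], p.clock⟩}
  | some (.and _ _) => {⟨p.world, p.addr ++ [0], p.clock⟩, ⟨p.world, p.addr ++ [1], p.clock⟩}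
  | some (.dia _) => {q | ∃ v, M.R p.world v ∧ q = ⟨v, p.addr ++ [0], p.clock⟩}
  | some (.box _) => {q | ∃ v, M.R p.world v ∧ q = ⟨v, p.addr ++ [0], p.clock⟩}
  | some (.mu _ _) =>
      {q | ∃ γ < Γ, q = ⟨p.world, p.addr ++ [0], Function.update p.clock p.addr γ⟩}
  | some (.nu _ _) =>
      {q | ∃ γ < Γ, q = ⟨p.world, p.addr ++ [0], Function.update p.clock p.addr γ⟩}
  | some (.label X) =>
      match refOcc φ₀ X p.addr with
      | some r => {q | ∃ γ' < p.clock r, q = ⟨p.world, r ++ [0], clockReset Γ γ' r p.clock⟩}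
      | none => ∅
  | _ => ∅

/-- The winner of the game at an ending position: at `(w,p,c)` Eloise wins iff `w ∈ V(p)`,
at `(w,¬p,c)` iff `w ∉ V(p)`; at any other position with no available moves, the player
who should move loses (so Abelard wins at `◇` with no successor and at labels bound by `μ`
with clock value `0`, and dually for Eloise). -/
noncomputable def winsTerminal [DecidableEq Λ] (M : Kripke Φ W) (φ₀ : Formula Φ Λ)
    (p : GPos W) : Player :=
  match nodeAt φ₀ p.addr with
  | some (.atom q) => if p.world ∈ M.V q then .eloise else .abelard
  | some (.natom q) => if p.world ∈ M.V q then .abelard else .eloise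
  | _ =>
      match turn φ₀ p with
      | some .eloise => .abelard
      | _ => .eloise

/-- The initial position `(w₀, φ₀, c₀)` of the game, where `c₀` is constantly `Γ`. -/
def initPos (w₀ : W) (Γ : Ordinal) : GPos W := ⟨w₀, [], fun _ => Γ⟩

/-- `ConsPlay M φ₀ Γ w₀ P σ f` : the finite sequence of positions `f` is a (partial) play of
the Γ-bounded evaluation game `(M, w₀, φ₀, Γ)` in which player `P` follows the positional
strategy `σ`: it starts at the initial position, every step obeys the rules of the game,
and at every position where `P` moves, the move is the one prescribed by `σ`. -/
def ConsPlay [DecidableEq Λ] (M : Kripke Φ W) (φ₀ : Formula Φ Λ) (Γ : Ordinal) (w₀ : W)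
    (P : Player) (σ : GPos W → GPos W) (f : List (GPos W)) : Prop :=
  f.head? = some (initPos w₀ Γ) ∧
    ∀ i, (h : i + 1 < f.length) →
      f[i + 1] ∈ moves M φ₀ Γ (f[i]'(Nat.lt_of_succ_lt h)) ∧
        (turn φ₀ (f[i]'(Nat.lt_of_succ_lt h)) = some P →
          f[i + 1] = σ (f[i]'(Nat.lt_of_succ_lt h)))

/-- `WinStrat M φ₀ Γ w₀ P σ` : the (positional) strategy `σ` is a winning strategy for
player `P` in the Γ-bounded evaluation game `(M, w₀, φ₀, Γ)`: along any play in which `P`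
follows `σ`, whenever it is `P`'s turn and some move is available, `σ` prescribes a legal
move (so `P` can always continue playing according to `σ`), and every ending position ever
reached is winning for `P`. -/
noncomputable def WinStrat [DecidableEq Λ] (M : Kripke Φ W) (φ₀ : Formula Φ Λ)
    (Γ : Ordinal) (w₀ : W) (P : Player) (σ : GPos W → GPos W) : Prop :=
  ∀ f, ConsPlay M φ₀ Γ w₀ P σ f → ∀ p, f.getLast? = some p →
    (turn φ₀ p = some P → (moves M φ₀ Γ p).Nonempty → σ p ∈ moves M φ₀ Γ p) ∧
      (moves M φ₀ Γ p = ∅ → winsTerminal M φ₀ p = P)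

/-- The clauses of the game seen as a monotone operator: `E` is mapped to the set of positions
from which Eloise survives one round and can reach (or is forced to stay in) `E`. -/
def gameStep [DecidableEq Λ] (M : Kripke Φ W) (φ₀ : Formula Φ Λ) (Γ : Ordinal) :
    Set (GPos W) →o Set (GPos W) where
  toFun E := {p | (turn φ₀ p = some .eloise → ∃ q ∈ moves M φ₀ Γ p, q ∈ E) ∧
    (turn φ₀ p ≠ some .eloise → ∀ q ∈ moves M φ₀ Γ p, q ∈ E) ∧
    (moves M φ₀ Γ p = ∅ → winsTerminal M φ₀ p = .eloise)}
  monotone' := by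
    rintro E E' hE p ⟨h₁, h₂, h₃⟩
    refine ⟨fun h => ?_, fun h q hq => hE (h₂ h q hq), h₃⟩
    obtain ⟨q, hq, hqE⟩ := h₁ h
    exact ⟨q, hq, hE hqE⟩

theorem mem_gameStep [DecidableEq Λ] {M : Kripke Φ W} {φ₀ : Formula Φ Λ} {Γ : Ordinal}
    {E : Set (GPos W)} {p : GPos W} : p ∈ gameStep M φ₀ Γ E ↔
      (turn φ₀ p = some .eloise → ∃ q ∈ moves M φ₀ Γ p, q ∈ E) ∧
      (turn φ₀ p ≠ some .eloise → ∀ q ∈ moves M φ₀ Γ p, q ∈ E) ∧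
      (moves M φ₀ Γ p = ∅ → winsTerminal M φ₀ p = .eloise) := Iff.rfl

theorem winsTerminal_of_turn [DecidableEq Λ] (M : Kripke Φ W) {φ₀ : Formula Φ Λ} {p : GPos W}
    {P : Player} (h : turn φ₀ p = some P) :
    winsTerminal M φ₀ p = match P with | .eloise => .abelard | .abelard => .eloise := by
  have h' := h
  unfold winsTerminal
  unfold turn at h
  cases hn : nodeAt φ₀ p.addr with
  | none => simp [hn] at h
  | some χ => cases χ <;> simp [hn] at h <;> cases P <;> simp_all

theorem mem_gameStep_of_eloise [DecidableEq Λ] {M : Kripke Φ W} {φ₀ : Formula Φ Λ}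
    {Γ : Ordinal} {E : Set (GPos W)} {p : GPos W} (h : turn φ₀ p = some .eloise) :
    p ∈ gameStep M φ₀ Γ E ↔ ∃ q ∈ moves M φ₀ Γ p, q ∈ E := by
  rw [mem_gameStep]
  refine ⟨fun hp => hp.1 h, fun hp => ⟨fun _ => hp, fun hn => absurd h hn, fun he => ?_⟩⟩
  obtain ⟨q, hq, -⟩ := hp
  simp [he] at hq

theorem mem_gameStep_of_abelard [DecidableEq Λ] {M : Kripke Φ W} {φ₀ : Formula Φ Λ}
    {Γ : Ordinal} {E : Set (GPos W)} {p : GPos W} (h : turn φ₀ p = some .abelard) :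
    p ∈ gameStep M φ₀ Γ E ↔ ∀ q ∈ moves M φ₀ Γ p, q ∈ E := by
  rw [mem_gameStep]
  exact ⟨fun hp => hp.2.1 (by simp [h]),
    fun hp => ⟨fun h' => by simp [h] at h', fun _ => hp, fun _ => winsTerminal_of_turn M h⟩⟩

theorem sat_mono [DecidableEq Λ] (M : Kripke Φ W) (φ : Formula Φ Λ) :
    Monotone (sat M φ) := by
  have hup : ∀ {s t : Λ → Set W} (X : Λ) (A : Set W), s ≤ t →
      Function.update s X A ≤ Function.update t X A := fun X A h =>
    update_le_update_iff.2 ⟨le_rfl, fun Y _ => h Y⟩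
  induction φ with
  | atom p => exact fun s t h => le_rfl
  | natom p => exact fun s t h => le_rfl
  | label X => exact fun s t h => h X
  | or φ ψ ih₁ ih₂ => exact fun s t h => Set.union_subset_union (ih₁ h) (ih₂ h)
  | and φ ψ ih₁ ih₂ => exact fun s t h => Set.inter_subset_inter (ih₁ h) (ih₂ h)
  | dia φ ih => exact fun s t h w ⟨v, hv, hs⟩ => ⟨v, hv, ih h hs⟩
  | box φ ih => exact fun s t h w hw v hv => ih h (hw v hv)
  | mu X φ ih => exact fun s t h => sInf_le_sInf fun A hA => (ih (hup X A h)).trans hA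
  | nu X φ ih =>
    exact fun s t h => sSup_le_sSup fun A (hA : A ≤ _) => hA.trans (ih (hup X A h))

/-- The approximants of a least fixed point of a monotone operator on subsets of `W` reach it
before the successor cardinal of the cardinality of `W`. -/
theorem mem_sInf_prefixed_iff_exists_approx {F : Set W → Set W} (hF : Monotone F)
    {B : Ordinal.{0} → Set W} (hB : ∀ γ w, w ∈ B γ ↔ ∃ δ < γ, w ∈ F (B δ)) (w : W) :
    w ∈ sInf {A | F A ⊆ A} ↔ ∃ γ < (Order.succ (Cardinal.mk W)).ord, w ∈ F (B γ) := by
  constructor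
  · intro hw
    obtain ⟨γ, hγ, hfix⟩ : ∃ γ < (Order.succ (Cardinal.mk W)).ord, F (B γ) ⊆ B γ := by
      by_contra! hne
      have hne' : ∀ γ : Set.Iio (Order.succ (Cardinal.mk W)).ord,
          ∃ w, w ∈ F (B γ) ∧ w ∉ B γ := fun γ => Set.not_subset.1 (hne γ γ.2)
      choose f hf hf' using hne'
      have hinj : Function.Injective f := by
        intro γ δ h
        rcases lt_trichotomy γ δ with hlt | heq | hlt
        · exact absurd ((hB δ _).2 ⟨γ, hlt, hf γ⟩) (h ▸ hf' δ)
        · exact heq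
        · exact absurd ((hB γ _).2 ⟨δ, hlt, hf δ⟩) (h ▸ hf' γ)
      have hle := Cardinal.mk_le_of_injective
        (f := fun x : Set.Iio (Order.succ (Cardinal.mk W)).ord => ULift.up.{1} (f x))
        (fun x y hxy => hinj (ULift.up_injective hxy))
      rw [Cardinal.mk_Iio_ordinal, Cardinal.card_ord, Cardinal.mk_uLift,
        Cardinal.lift_le] at hle
      exact absurd hle (not_le.2 (Order.lt_succ _))
    obtain ⟨δ, hδ, h⟩ := (hB γ w).1 (Set.mem_sInter.1 hw (B γ) hfix)
    exact ⟨δ, hδ.trans hγ, h⟩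
  · rintro ⟨γ, -, hw⟩
    refine Set.mem_sInter.2 fun A (hA : F A ⊆ A) => ?_
    have hsub : ∀ γ, B γ ⊆ A := by
      intro γ
      induction γ using WellFoundedLT.induction with
      | ind γ ih =>
        intro v hv
        obtain ⟨δ, hδ, h⟩ := (hB γ v).1 hv
        exact hA (hF (ih δ hδ) h)
    exact hA (hF (hsub γ) hw)

theorem mem_sSup_postfixed_iff_forall_approx {F : Set W → Set W} (hF : Monotone F)
    {B : Ordinal.{0} → Set W} (hB : ∀ γ w, w ∈ B γ ↔ ∀ δ < γ, w ∈ F (B δ)) (w : W) :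
    w ∈ sSup {A | A ⊆ F A} ↔ ∀ γ < (Order.succ (Cardinal.mk W)).ord, w ∈ F (B γ) := by
  have key := mem_sInf_prefixed_iff_exists_approx (F := fun A => (F Aᶜ)ᶜ)
    (fun A A' h => Set.compl_subset_compl.2 (hF (Set.compl_subset_compl.2 h)))
    (B := fun γ => (B γ)ᶜ) (fun γ w => by simp [hB γ w]) w
  rw [← not_iff_not]
  push Not
  simp only [compl_compl, Set.mem_compl_iff] at key
  rw [← key]
  simp only [Set.sSup_eq_sUnion, Set.sInf_eq_sInter, Set.mem_sUnion, Set.mem_sInter,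
    Set.mem_ofPred_eq]
  push Not
  constructor
  · intro h A hA
    by_contra hw
    exact h Aᶜ (Set.compl_subset_comm.1 hA) hw
  · intro h A hA hw
    exact h Aᶜ (by simpa using hA) hw

theorem nodeAt_append (φ : Formula Φ Λ) (a b : List ℕ) :
    nodeAt φ (a ++ b) = (nodeAt φ a).bind (nodeAt · b) := by
  induction a generalizing φ with
  | nil => simp [nodeAt]
  | cons i t ih =>
    rcases i with _ | _ | i <;> cases φ <;> simp [nodeAt, ih]

theorem refOcc_append_singleton [DecidableEq Λ] (φ₀ : Formula Φ Λ) (X : Λ) (a : List ℕ)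
    (i : ℕ) : refOcc φ₀ X (a ++ [i]) =
      if bindsAt φ₀ X (a ++ [i]) then some (a ++ [i]) else refOcc φ₀ X a := by
  unfold refOcc
  rw [List.inits_append]
  split_ifs with h <;> simp [List.filter_append, h]

theorem refOcc_of_bindsAt [DecidableEq Λ] {φ₀ : Formula Φ Λ} {X : Λ} {a : List ℕ}
    (h : bindsAt φ₀ X a) : refOcc φ₀ X a = some a := by
  rcases List.eq_nil_or_concat a with rfl | ⟨b, i, rfl⟩
  · simp [refOcc, h]
  · rw [List.concat_eq_append] at h ⊢
    rw [refOcc_append_singleton, if_pos h]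

theorem not_bindsAt_of_mem_freeLabels [DecidableEq Λ] {φ₀ ψ : Formula Φ Λ} {X : Λ}
    {a : List ℕ} (h : nodeAt φ₀ a = some ψ) (hX : X ∈ freeLabels ψ) :
    ¬ bindsAt φ₀ X a := by
  unfold bindsAt
  rw [h]
  cases ψ <;> simp_all [freeLabels, eq_comm]

/-- `LabelSound φ₀ Γ E a c s X`: the label `X`, seen from address `a`, has a reference formula
properly above `a`, and `s X` consists of the worlds from which the move regenerating that
reference formula under the clock mapping `c` keeps the play in `E`. -/
def LabelSound [DecidableEq Λ] (φ₀ : Formula Φ Λ) (Γ : Ordinal) (E : Set (GPos W))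
    (a : List ℕ) (c : List ℕ → Ordinal) (s : Λ → Set W) (X : Λ) : Prop :=
  ∃ r, refOcc φ₀ X a = some r ∧ r ++ [0] <+: a ∧
    (((∃ Y χ, nodeAt φ₀ r = some (.mu Y χ)) ∧
        ∀ w, w ∈ s X ↔ ∃ γ < c r, ⟨w, r ++ [0], clockReset Γ γ r c⟩ ∈ E) ∨
      ((∃ Y χ, nodeAt φ₀ r = some (.nu Y χ)) ∧
        ∀ w, w ∈ s X ↔ ∀ γ < c r, ⟨w, r ++ [0], clockReset Γ γ r c⟩ ∈ E))

theorem clockReset_congr {Γ γ : Ordinal} {r : List ℕ} {c c' : List ℕ → Ordinal}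
    (hc : ∀ o, o ≠ r → ¬ r ++ [0] <+: o → c' o = c o) :
    clockReset Γ γ r c' = clockReset Γ γ r c := by
  funext o
  unfold clockReset
  split_ifs with h₁ h₂
  · rfl
  · rfl
  · exact hc o h₁ fun h => h₂ (List.isPrefixOf_iff_prefix.2 h)

theorem clockReset_self (Γ γ : Ordinal) (r : List ℕ) (c : List ℕ → Ordinal) :
    clockReset Γ γ r c r = γ := by
  simp [clockReset]

theorem clockReset_of_not_prefix (Γ γ : Ordinal) {r o : List ℕ} (c : List ℕ → Ordinal)
    (h₁ : o ≠ r) (h₂ : ¬ r ++ [0] <+: o) : clockReset Γ γ r c o = c o := by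
  unfold clockReset
  rw [if_neg h₁, if_neg (mt List.isPrefixOf_iff_prefix.1 h₂)]

/-- Soundness of a label free in a child of `a` is preserved when only clocks at or below `a`
change. -/
theorem LabelSound.child [DecidableEq Λ] {φ₀ χ : Formula Φ Λ} {Γ : Ordinal}
    {E : Set (GPos W)} {a : List ℕ} {c c' : List ℕ → Ordinal} {s s' : Λ → Set W} {X : Λ}
    (h : LabelSound φ₀ Γ E a c s X) {i : ℕ} (hn : nodeAt φ₀ (a ++ [i]) = some χ)
    (hX : X ∈ freeLabels χ) (hc : ∀ o, ¬ a <+: o → c' o = c o) (hs : s' X = s X) :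
    LabelSound φ₀ Γ E (a ++ [i]) c' s' X := by
  obtain ⟨r, hr, hra, h⟩ := h
  refine ⟨r, ?_, hra.trans (List.prefix_append a [i]), ?_⟩
  · rw [refOcc_append_singleton, if_neg (not_bindsAt_of_mem_freeLabels hn hX), hr]
  · have hcr : c' r = c r := hc r fun h => by
      have := (hra.trans h).length_le
      simp at this
    have hreset : ∀ γ, clockReset Γ γ r c' = clockReset Γ γ r c := fun γ =>
      clockReset_congr fun o _ ho => hc o fun h => ho (hra.trans h)
    simpa only [hs, hcr, hreset] using h

/-- At a fixed point `E` of the game operator, membership of a position in `E` agrees with the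
compositional semantics, relative to an assignment that is sound for the free labels. -/
theorem mem_iff_mem_sat [DecidableEq Λ] {M : Kripke Φ W} {φ₀ : Formula Φ Λ}
    {E : Set (GPos W)} (hE : gameStep M φ₀ (Order.succ (Cardinal.mk W)).ord E = E)
    (ψ : Formula Φ Λ) (a : List ℕ) (c : List ℕ → Ordinal) (s : Λ → Set W) (w : W)
    (hn : nodeAt φ₀ a = some ψ)
    (hs : ∀ X ∈ freeLabels ψ, LabelSound φ₀ (Order.succ (Cardinal.mk W)).ord E a c s X) :
    (⟨w, a, c⟩ : GPos W) ∈ E ↔ w ∈ sat M ψ s := by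
  induction ψ generalizing a c s w with
  | atom p => rw [← hE]; simp [mem_gameStep, turn, moves, winsTerminal, hn, sat]
  | natom p => rw [← hE]; simp [mem_gameStep, turn, moves, winsTerminal, hn, sat]
  | label X =>
    obtain ⟨r, hr, -, ⟨⟨Y, χ, hχ⟩, h⟩ | ⟨⟨Y, χ, hχ⟩, h⟩⟩ := hs X rfl
    · have ht : turn φ₀ (⟨w, a, c⟩ : GPos W) = some .eloise := by simp [turn, hn, hr, hχ]
      rw [← hE, mem_gameStep_of_eloise ht]
      simp [moves, hn, hr, sat, h]
    · have ht : turn φ₀ (⟨w, a, c⟩ : GPos W) = some .abelard := by simp [turn, hn, hr, hχ]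
      rw [← hE, mem_gameStep_of_abelard ht]
      simp only [moves, hn, hr, sat, h, Set.mem_ofPred_eq]
      exact ⟨fun h γ hγ => h _ ⟨γ, hγ, rfl⟩, fun h q ⟨γ, hγ, hq⟩ => hq ▸ h γ hγ⟩
  | or φ ψ ih₁ ih₂ =>
    have hn₁ : nodeAt φ₀ (a ++ [0]) = some φ := by simp [nodeAt_append, hn, nodeAt]
    have hn₂ : nodeAt φ₀ (a ++ [1]) = some ψ := by simp [nodeAt_append, hn, nodeAt]
    have ht : turn φ₀ (⟨w, a, c⟩ : GPos W) = some .eloise := by simp [turn, hn]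
    rw [← hE, mem_gameStep_of_eloise ht]
    simp [moves, hn, sat,
      ih₁ _ c s w hn₁ fun X hX => (hs X (.inl hX)).child hn₁ hX (fun _ _ => rfl) rfl,
      ih₂ _ c s w hn₂ fun X hX => (hs X (.inr hX)).child hn₂ hX (fun _ _ => rfl) rfl]
  | and φ ψ ih₁ ih₂ =>
    have hn₁ : nodeAt φ₀ (a ++ [0]) = some φ := by simp [nodeAt_append, hn, nodeAt]
    have hn₂ : nodeAt φ₀ (a ++ [1]) = some ψ := by simp [nodeAt_append, hn, nodeAt]
    have ht : turn φ₀ (⟨w, a, c⟩ : GPos W) = some .abelard := by simp [turn, hn]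
    rw [← hE, mem_gameStep_of_abelard ht]
    simp [moves, hn, sat,
      ih₁ _ c s w hn₁ fun X hX => (hs X (.inl hX)).child hn₁ hX (fun _ _ => rfl) rfl,
      ih₂ _ c s w hn₂ fun X hX => (hs X (.inr hX)).child hn₂ hX (fun _ _ => rfl) rfl]
  | dia φ ih =>
    have hn₁ : nodeAt φ₀ (a ++ [0]) = some φ := by simp [nodeAt_append, hn, nodeAt]
    have ht : turn φ₀ (⟨w, a, c⟩ : GPos W) = some .eloise := by simp [turn, hn]
    have ih' := fun v =>
      ih _ c s v hn₁ fun X hX => (hs X hX).child hn₁ hX (fun _ _ => rfl) rfl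
    rw [← hE, mem_gameStep_of_eloise ht]
    simp [moves, hn, sat, ← ih']
  | box φ ih =>
    have hn₁ : nodeAt φ₀ (a ++ [0]) = some φ := by simp [nodeAt_append, hn, nodeAt]
    have ht : turn φ₀ (⟨w, a, c⟩ : GPos W) = some .abelard := by simp [turn, hn]
    have ih' := fun v =>
      ih _ c s v hn₁ fun X hX => (hs X hX).child hn₁ hX (fun _ _ => rfl) rfl
    rw [← hE, mem_gameStep_of_abelard ht]
    simp only [moves, hn, sat, ← ih', Set.mem_ofPred_eq]
    exact ⟨fun h v hv => h _ ⟨v, hv, rfl⟩, fun h q ⟨v, hv, hq⟩ => hq ▸ h v hv⟩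
  | mu X φ ih =>
    have hn₁ : nodeAt φ₀ (a ++ [0]) = some φ := by simp [nodeAt_append, hn, nodeAt]
    have ht : turn φ₀ (⟨w, a, c⟩ : GPos W) = some .eloise := by simp [turn, hn]
    set Γ := (Order.succ (Cardinal.mk W)).ord
    let B : Ordinal → Set W := fun γ =>
      {v | ∃ δ < γ, (⟨v, a ++ [0], clockReset Γ δ a c⟩ : GPos W) ∈ E}
    have ih' : ∀ (γ : Ordinal) (c' : List ℕ → Ordinal) (v : W), c' a = γ →
        (∀ o, o ≠ a → ¬ a ++ [0] <+: o → c' o = c o) →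
        ((⟨v, a ++ [0], c'⟩ : GPos W) ∈ E ↔ v ∈ sat M φ (Function.update s X (B γ))) := by
      intro γ c' v hγ hc'
      refine ih _ c' _ v hn₁ fun Y hY => ?_
      by_cases hYX : Y = X
      · subst hYX
        refine ⟨a, ?_, List.prefix_rfl, .inl ⟨⟨_, _, hn⟩, fun v => ?_⟩⟩
        · rw [refOcc_append_singleton, if_neg (not_bindsAt_of_mem_freeLabels hn₁ hY),
            refOcc_of_bindsAt (by simp [bindsAt, hn])]
        · have hreset : ∀ δ, clockReset Γ δ a c' = clockReset Γ δ a c := fun δ =>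
            clockReset_congr hc'
          simp [B, hγ, hreset]
      · have hoff : ∀ o, ¬ a <+: o → c' o = c o := fun o ho =>
          hc' o (fun h => ho (h ▸ List.prefix_rfl))
            fun h => ho ((List.prefix_append a [0]).trans h)
        exact (hs Y ⟨hY, hYX⟩).child hn₁ hY hoff (Function.update_of_ne hYX _ _)
    have hreset : ∀ γ v, (⟨v, a ++ [0], clockReset Γ γ a c⟩ : GPos W) ∈ E ↔
        v ∈ sat M φ (Function.update s X (B γ)) := fun γ v =>
      ih' γ _ v (clockReset_self ..) fun o => clockReset_of_not_prefix _ _ _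
    have key := mem_sInf_prefixed_iff_exists_approx
      (F := fun A => sat M φ (Function.update s X A))
      (fun A A' h => sat_mono M φ (Function.update_mono h)) (B := B)
      (fun γ v => by simp only [← hreset]; rfl) w
    rw [← hE, mem_gameStep_of_eloise ht]
    refine Iff.trans ?_ key.symm
    have hupd : ∀ γ, (⟨w, a ++ [0], Function.update c a γ⟩ : GPos W) ∈ E ↔
        w ∈ sat M φ (Function.update s X (B γ)) := fun γ =>
      ih' γ _ w (Function.update_self ..) fun o ho _ =>
        Function.update_of_ne ho _ _
    simp [moves, hn, ← hupd, Γ]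
  | nu X φ ih =>
    have hn₁ : nodeAt φ₀ (a ++ [0]) = some φ := by simp [nodeAt_append, hn, nodeAt]
    have ht : turn φ₀ (⟨w, a, c⟩ : GPos W) = some .abelard := by simp [turn, hn]
    set Γ := (Order.succ (Cardinal.mk W)).ord
    let B : Ordinal → Set W := fun γ =>
      {v | ∀ δ < γ, (⟨v, a ++ [0], clockReset Γ δ a c⟩ : GPos W) ∈ E}
    have ih' : ∀ (γ : Ordinal) (c' : List ℕ → Ordinal) (v : W), c' a = γ →
        (∀ o, o ≠ a → ¬ a ++ [0] <+: o → c' o = c o) →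
        ((⟨v, a ++ [0], c'⟩ : GPos W) ∈ E ↔ v ∈ sat M φ (Function.update s X (B γ))) := by
      intro γ c' v hγ hc'
      refine ih _ c' _ v hn₁ fun Y hY => ?_
      by_cases hYX : Y = X
      · subst hYX
        refine ⟨a, ?_, List.prefix_rfl, .inr ⟨⟨_, _, hn⟩, fun v => ?_⟩⟩
        · rw [refOcc_append_singleton, if_neg (not_bindsAt_of_mem_freeLabels hn₁ hY),
            refOcc_of_bindsAt (by simp [bindsAt, hn])]
        · have hreset : ∀ δ, clockReset Γ δ a c' = clockReset Γ δ a c := fun δ =>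
            clockReset_congr hc'
          simp [B, hγ, hreset]
      · have hoff : ∀ o, ¬ a <+: o → c' o = c o := fun o ho =>
          hc' o (fun h => ho (h ▸ List.prefix_rfl))
            fun h => ho ((List.prefix_append a [0]).trans h)
        exact (hs Y ⟨hY, hYX⟩).child hn₁ hY hoff (Function.update_of_ne hYX _ _)
    have hreset : ∀ γ v, (⟨v, a ++ [0], clockReset Γ γ a c⟩ : GPos W) ∈ E ↔
        v ∈ sat M φ (Function.update s X (B γ)) := fun γ v =>
      ih' γ _ v (clockReset_self ..) fun o => clockReset_of_not_prefix _ _ _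
    have key := mem_sSup_postfixed_iff_forall_approx
      (F := fun A => sat M φ (Function.update s X A))
      (fun A A' h => sat_mono M φ (Function.update_mono h)) (B := B)
      (fun γ v => by simp only [← hreset]; rfl) w
    rw [← hE, mem_gameStep_of_abelard ht]
    refine Iff.trans ?_ key.symm
    have hupd : ∀ γ, (⟨w, a ++ [0], Function.update c a γ⟩ : GPos W) ∈ E ↔
        w ∈ sat M φ (Function.update s X (B γ)) := fun γ =>
      ih' γ _ w (Function.update_self ..) fun o ho _ =>
        Function.update_of_ne ho _ _
    simp only [moves, hn, ← hupd, Set.mem_ofPred_eq]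
    exact ⟨fun h γ hγ => h _ ⟨γ, hγ, rfl⟩, fun h q ⟨γ, hγ, hq⟩ => hq ▸ h γ hγ⟩

/-- Eloise has a winning strategy exactly when the initial position lies in the greatest fixed
point of the game operator. -/
theorem exists_winStrat_iff_mem_gfp [DecidableEq Λ] (M : Kripke Φ W) (φ₀ : Formula Φ Λ)
    (Γ : Ordinal) (w : W) :
    (∃ σ, WinStrat M φ₀ Γ w .eloise σ) ↔ initPos w Γ ∈ (gameStep M φ₀ Γ).gfp := by
  constructor
  · rintro ⟨σ, hσ⟩
    let S : Set (GPos W) := {p | ∃ f, ConsPlay M φ₀ Γ w .eloise σ f ∧ f.getLast? = some p}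
    have hext : ∀ {p q}, p ∈ S → q ∈ moves M φ₀ Γ p →
        (turn φ₀ p = some .eloise → q = σ p) → q ∈ S := by
      rintro p q ⟨f, ⟨hhd, hf⟩, hlast⟩ hq hqσ
      refine ⟨f ++ [q], ⟨by simp [hhd], fun i hi => ?_⟩, by simp⟩
      rw [List.length_append, List.length_singleton] at hi
      rcases Nat.lt_or_ge (i + 1) f.length with hlt | hge
      · simpa [List.getElem_append, hlt, Nat.lt_of_succ_lt hlt] using hf i hlt
      · have hlen : f.length = i + 1 := by omega
        have hp : f[i] = p := by
          rw [List.getLast?_eq_getElem?, hlen] at hlast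
          obtain ⟨_, h⟩ := List.getElem?_eq_some_iff.1 hlast
          exact h
        have h₁ : (f ++ [q])[i]'(by simp; omega) = p := by
          rw [List.getElem_append_left (by omega), hp]
        have h₂ : (f ++ [q])[i + 1]'(by simp; omega) = q := by
          rw [List.getElem_append_right (by omega)]; simp
        rw [h₁, h₂]
        exact ⟨hq, hqσ⟩
    have hS : S ⊆ gameStep M φ₀ Γ S := by
      intro p hp
      obtain ⟨f, hf, hlast⟩ := id hp
      obtain ⟨hmove, hend⟩ := hσ f hf p hlast
      refine ⟨fun ht => ?_, fun ht q hq => hext hp hq fun h => absurd h ht, hend⟩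
      have hne : (moves M φ₀ Γ p).Nonempty := by
        by_contra hempty
        have := hend (Set.not_nonempty_iff_eq_empty.1 hempty)
        rw [winsTerminal_of_turn M ht] at this
        cases this
      exact ⟨σ p, hmove ht hne, hext hp (hmove ht hne) fun _ => rfl⟩
    exact (gameStep M φ₀ Γ).le_gfp hS ⟨[initPos w Γ], ⟨rfl, by simp⟩, rfl⟩
  · intro hw
    set E := (gameStep M φ₀ Γ).gfp with hE
    have hstep : ∀ p ∈ E, p ∈ gameStep M φ₀ Γ E := fun p hp => by
      rwa [hE, OrderHom.map_gfp]
    have hchoice : ∀ p, ∃ q, p ∈ E → turn φ₀ p = some .eloise → q ∈ moves M φ₀ Γ p ∧ q ∈ E := by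
      intro p
      by_cases hp : p ∈ E ∧ turn φ₀ p = some .eloise
      · obtain ⟨q, hq⟩ := (hstep p hp.1).1 hp.2
        exact ⟨q, fun _ _ => hq⟩
      · exact ⟨p, fun h₁ h₂ => absurd ⟨h₁, h₂⟩ hp⟩
    choose σ hσ using hchoice
    refine ⟨σ, fun f ⟨hhd, hf⟩ p hlast => ?_⟩
    have hall : ∀ i (hi : i < f.length), f[i] ∈ E := by
      intro i
      induction i with
      | zero =>
        intro hi
        rw [List.head?_eq_getElem?] at hhd
        obtain ⟨_, h⟩ := List.getElem?_eq_some_iff.1 hhd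
        rwa [h]
      | succ i ih =>
        intro hi
        have hiE := ih (Nat.lt_of_succ_lt hi)
        obtain ⟨hm, hP⟩ := hf i hi
        by_cases ht : turn φ₀ f[i] = some .eloise
        · rw [hP ht]
          exact (hσ _ hiE ht).2
        · exact (hstep _ hiE).2.1 ht _ hm
    have hpE : p ∈ E := by
      rw [List.getLast?_eq_getElem?] at hlast
      obtain ⟨h, rfl⟩ := List.getElem?_eq_some_iff.1 hlast
      exact hall _ h
    exact ⟨fun ht _ => (hσ p hpE ht).1, (hstep p hpE).2.2⟩

/-- For a Kripke model `M`, a world `w`, a sentence `φ` of the modal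
μ-calculus in normal form, and `Γ` the successor cardinal of the cardinality of `W`
(regarded as an ordinal): `M,w ⊨ φ` in the standard compositional semantics (truth of a
sentence being independent of the assignment) iff Eloise has a winning strategy in the
Γ-bounded evaluation game `(M, w, φ, Γ)`. -/
theorem gts_equiv_standard_at_succ_card [DecidableEq Λ] [Nonempty W] (M : Kripke Φ W)
    (w : W) (φ : Formula Φ Λ) (hsen : IsSentence φ) (hnf : NormalForm φ) :
    (∀ s, w ∈ sat M φ s) ↔
      ∃ σ, WinStrat M φ (Order.succ (Cardinal.mk W)).ord w Player.eloise σ := by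
  have hmem := fun s => mem_iff_mem_sat (M := M) (φ₀ := φ) (OrderHom.map_gfp _) φ []
    (fun _ => (Order.succ (Cardinal.mk W)).ord) s w (by simp [nodeAt])
    (fun X hX => by rw [hsen] at hX; exact hX.elim)
  rw [exists_winStrat_iff_mem_gfp]
  exact ⟨fun h => (hmem fun _ => ∅).2 (h _), fun h s => (hmem s).1 h⟩
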